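/- arXiv:quant-ph/0412030 — 10 statements merged into one kernel-verified Lean document; each statement's English description precedes it below -/
import Mathlib

section
/- Let d ≥ 1 and let (ρ_a), a ranging over a (possibly infinite) index type ι, be a family of positive semidefinite matrices in Matrix (Fin d) (Fin d) ℂ such that the supremum of the ranges of the associated linear maps ρ_a : ℂ^d → ℂ^d is all of ℂ^d. If R is a positive semidefinite matrix in Matrix (Fin d) (Fin d) ℂ with Tr(ρ_a * R) = 0 for every a, then R = 0. -/
open scoped Matrix ComplexOrder

open scoped MatrixOrder in
/-- Two positive semidefinite matrices whose product has trace zero have product zero. -/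
theorem Matrix.PosSemidef.mul_eq_zero_of_trace_mul_eq_zero {n 𝕜 : Type*} [Fintype n]
    [RCLike 𝕜] {A B : Matrix n n 𝕜} (hA : A.PosSemidef) (hB : B.PosSemidef)
    (h : (A * B).trace = 0) : B * A = 0 := by
  classical
  obtain ⟨X, rfl⟩ := CStarAlgebra.nonneg_iff_eq_star_mul_self.mp hA.nonneg
  obtain ⟨Y, rfl⟩ := CStarAlgebra.nonneg_iff_eq_star_mul_self.mp hB.nonneg
  simp only [Matrix.star_eq_conjTranspose] at h ⊢
  have hYX : Y * Xᴴ = 0 := by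
    rw [← Matrix.trace_conjTranspose_mul_self_eq_zero_iff, ← h, Matrix.conjTranspose_mul,
      Matrix.conjTranspose_conjTranspose, ← Matrix.mul_assoc, Matrix.trace_mul_comm]
    simp only [Matrix.mul_assoc]
  rw [Matrix.mul_assoc, ← Matrix.mul_assoc Y, hYX, Matrix.zero_mul, Matrix.mul_zero]

/-- Appendix Lemma: if the ranges of a family of PSD (density) matrices generate the
whole space, then a PSD matrix with vanishing expectation in each state vanishes. -/
theorem stmt_0 {d : ℕ} (hd : 1 ≤ d) {ι : Type*} (ρ : ι → Matrix (Fin d) (Fin d) ℂ)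
    (hρ : ∀ a, (ρ a).PosSemidef)
    (hspan : (⨆ a, LinearMap.range (Matrix.toLin' (ρ a))) = ⊤)
    (R : Matrix (Fin d) (Fin d) ℂ) (hR : R.PosSemidef)
    (h0 : ∀ a, (ρ a * R).trace = 0) : R = 0 := by
  have hker : (⨆ a, LinearMap.range (Matrix.toLin' (ρ a))) ≤ LinearMap.ker (Matrix.toLin' R) := by
    refine iSup_le fun a => LinearMap.range_le_ker_iff.mpr ?_
    rw [← Matrix.toLin'_mul, (hρ a).mul_eq_zero_of_trace_mul_eq_zero hR (h0 a), map_zero]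
  rw [hspan, top_le_iff, LinearMap.ker_eq_top] at hker
  exact Matrix.toLin'.map_eq_zero_iff.mp hker
end

section
/- Let Π : Fin N → Matrix (Fin n) (Fin n) ℂ be a finite POVM (each Π j PSD and ∑ j, Π j = 1), let λ : Fin N → ℂ, and set q := ∑ j, λ j • Π j. Then the matrix (∑ j, ‖λ j‖² • Π j) − q * qᴴ is positive semidefinite. -/
open scoped Matrix ComplexOrder

/-- The defect `∑ ‖l j‖² • P j − q qᴴ` is the sum of the `P j` conjugated by `l j − q`. -/
lemma sum_normSq_smul_sub_mul_conjTranspose {m ι : Type*} [Fintype m] [DecidableEq m] [Fintype ι]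
    (P : ι → Matrix m m ℂ) (hP : ∀ j, (P j).IsHermitian) (hPsum : ∑ j, P j = 1)
    (l : ι → ℂ) (q : Matrix m m ℂ) (hq : q = ∑ j, l j • P j) :
    (∑ j, ((‖l j‖ ^ 2 : ℝ) : ℂ) • P j) - q * qᴴ =
      ∑ j, (l j • 1 - q) * P j * (l j • 1 - q)ᴴ := by
  have hq' : qᴴ = ∑ j, star (l j) • P j := by
    simp only [hq, Matrix.conjTranspose_sum, Matrix.conjTranspose_smul, (hP _).eq]
  have expand : ∀ j, (l j • 1 - q) * P j * (l j • 1 - q)ᴴ =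
      ((‖l j‖ ^ 2 : ℝ) : ℂ) • P j - (l j • P j) * qᴴ - q * (star (l j) • P j)
        + q * P j * qᴴ := by
    intro j
    have hnorm : ((‖l j‖ ^ 2 : ℝ) : ℂ) = star (l j) * l j := by
      rw [Complex.ofReal_pow, ← Complex.conj_mul']
      rfl
    simp only [hnorm, Matrix.conjTranspose_sub, Matrix.conjTranspose_smul,
      Matrix.conjTranspose_one, sub_mul, mul_sub, smul_mul_assoc, mul_smul_comm, one_mul, mul_one,
      smul_sub, smul_smul]
    abel
  simp only [expand, Finset.sum_add_distrib, Finset.sum_sub_distrib, ← Finset.sum_mul,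
    ← Finset.mul_sum, hPsum, ← hq, ← hq', mul_one]
  abel

/-- For a finite POVM `P` with outcome values `l` and estimate operator `q = ∑ l j • P j`,
the matrix `∑ ‖l j‖² • P j − q qᴴ` is positive semidefinite. -/
theorem stmt_1 {n N : ℕ} (hn : 1 ≤ n) (P : Fin N → Matrix (Fin n) (Fin n) ℂ)
    (hP : ∀ j, (P j).PosSemidef) (hPsum : ∑ j, P j = 1)
    (l : Fin N → ℂ) (q : Matrix (Fin n) (Fin n) ℂ) (hq : q = ∑ j, l j • P j) :
    ((∑ j, ((‖l j‖ ^ 2 : ℝ) : ℂ) • P j) - q * qᴴ).PosSemidef := by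
  rw [sum_normSq_smul_sub_mul_conjTranspose P (fun j => (hP j).isHermitian) hPsum l q hq]
  exact Matrix.posSemidef_sum _ fun j _ => (hP j).mul_mul_conjTranspose_same _
end

section
/- Let Π : Fin N → Matrix (Fin n) (Fin n) ℂ be a finite POVM, λ : Fin N → ℂ, q := ∑ j, λ j • Π j. Then for every c ∈ ℂ one has the operator identity ∑ j, ((λ j − c) * conj (λ j − c)) • Π j = (∑ j, (λ j • 1 − q) * Π j * (λ j • 1 − q)ᴴ) + (q − c • 1) * (q − c • 1)ᴴ, and in particular both summands on the right are positive semidefinite. -/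
open scoped Matrix ComplexOrder

/-- The measurement-noise part equals the second moment operator minus `q * qᴴ`. -/
theorem sum_noise_eq {n N : ℕ} (P : Fin N → Matrix (Fin n) (Fin n) ℂ)
    (hP : ∀ j, (P j).IsHermitian) (hPsum : ∑ j, P j = 1)
    (l : Fin N → ℂ) (q : Matrix (Fin n) (Fin n) ℂ) (hq : q = ∑ j, l j • P j) :
    ∑ j, (l j • 1 - q) * P j * (l j • 1 - q)ᴴ =
      ∑ j, (l j * star (l j)) • P j - q * qᴴ := by
  have hqH : ∑ j, star (l j) • P j = qᴴ := by
    simp [hq, Matrix.conjTranspose_sum, Matrix.conjTranspose_smul, (hP _).eq]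
  have hterm (j : Fin N) : (l j • 1 - q) * P j * (l j • 1 - q)ᴴ =
      (l j * star (l j)) • P j - (l j • P j) * qᴴ - q * (star (l j) • P j) + q * P j * qᴴ := by
    simp only [Matrix.conjTranspose_sub, Matrix.conjTranspose_smul, Matrix.conjTranspose_one,
      sub_mul, mul_sub, smul_mul_assoc, mul_smul_comm, one_mul, mul_one, mul_smul, smul_sub]
    rw [smul_comm (star (l j)) (l j)]
    abel
  simp only [hterm, Finset.sum_add_distrib, Finset.sum_sub_distrib, ← Finset.sum_mul,
    ← Finset.mul_sum, hqH, ← hq, hPsum, mul_one]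
  abel

/-- Decomposition of the mean-square error operator into the measurement-noise part and the
operator-deviation part, both positive semidefinite. -/
theorem stmt_2 {n N : ℕ} (P : Fin N → Matrix (Fin n) (Fin n) ℂ)
    (hP : ∀ j, (P j).PosSemidef) (hPsum : ∑ j, P j = 1)
    (l : Fin N → ℂ) (q : Matrix (Fin n) (Fin n) ℂ) (hq : q = ∑ j, l j • P j) (c : ℂ) :
    (∑ j, ((l j - c) * (starRingEnd ℂ) (l j - c)) • P j =
        (∑ j, (l j • 1 - q) * P j * (l j • 1 - q)ᴴ) + (q - c • 1) * (q - c • 1)ᴴ) ∧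
    (∑ j, (l j • 1 - q) * P j * (l j • 1 - q)ᴴ).PosSemidef ∧
    ((q - c • 1) * (q - c • 1)ᴴ).PosSemidef := by
  refine ⟨?_, Matrix.posSemidef_sum _ fun j _ => (hP j).mul_mul_conjTranspose_same _,
    Matrix.posSemidef_self_mul_conjTranspose _⟩
  have hshift := sum_noise_eq P (fun j => (hP j).isHermitian) hPsum (fun j => l j - c)
    (q - c • 1) (by simp [sub_smul, Finset.sum_sub_distrib, ← Finset.smul_sum, hPsum, hq])
  have hcancel (j : Fin N) :
      (l j - c) • (1 : Matrix (Fin n) (Fin n) ℂ) - (q - c • 1) = l j • 1 - q := by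
    rw [sub_smul]
    abel
  simp only [hcancel] at hshift
  rw [hshift, sub_add_cancel]
  rfl
end

section
/- Let ρ be a density matrix and Π : Fin N → Matrix (Fin n) (Fin n) ℂ a finite POVM with outcome values λ : Fin N → ℂ, q := ∑ j, λ j • Π j, and θ := Tr(ρ * q). Then the measurement variance dominates the operator variance: ∑ j, ‖λ j − θ‖² * (Tr(ρ * Π j)).re ≥ (Tr(ρ * (q − θ • 1) * (q − θ • 1)ᴴ)).re. -/
open scoped Matrix ComplexOrder

open scoped MatrixOrder in
/-- The trace of a product of two positive semidefinite matrices is nonnegative. -/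
theorem Matrix.PosSemidef.re_trace_mul_nonneg {m : Type*} [Fintype m] [DecidableEq m]
    {A B : Matrix m m ℂ} (hA : A.PosSemidef) (hB : B.PosSemidef) :
    0 ≤ ((A * B).trace).re := by
  obtain ⟨C, rfl⟩ : ∃ C : Matrix m m ℂ, A = Cᴴ * C :=
    CStarAlgebra.nonneg_iff_eq_star_mul_self.mp hA.nonneg
  rw [Matrix.mul_assoc, Matrix.trace_mul_comm]
  exact (Complex.le_def.mp (hB.mul_mul_conjTranspose_same C).trace_nonneg).1

/-- The second moment of a POVM minus the square of its first moment, as a sum of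
conjugates of the effects. -/
theorem sum_conj_povm_eq {m ι : Type*} [Fintype m] [DecidableEq m] [Fintype ι]
    {P : ι → Matrix m m ℂ} (hP : ∀ j, (P j).IsHermitian) (hPsum : ∑ j, P j = 1)
    (c : ι → ℂ) {X : Matrix m m ℂ} (hX : X = ∑ j, c j • P j) :
    ∑ j, (c j • 1 - X) * P j * (c j • 1 - X)ᴴ =
      ∑ j, ((‖c j‖ ^ 2 : ℝ) : ℂ) • P j - X * Xᴴ := by
  have hXH : Xᴴ = ∑ j, star (c j) • P j := by
    simp [hX, Matrix.conjTranspose_sum, Matrix.conjTranspose_smul, fun j => (hP j).eq]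
  have key : ∀ j, (c j • 1 - X) * P j * (c j • 1 - X)ᴴ =
      ((‖c j‖ ^ 2 : ℝ) : ℂ) • P j - (c j • P j) * Xᴴ - X * (star (c j) • P j)
        + X * P j * Xᴴ := by
    intro j
    have hc : ((‖c j‖ ^ 2 : ℝ) : ℂ) = star (c j) * c j := by
      push_cast
      exact (Complex.conj_mul' (c j)).symm
    rw [hc]
    simp only [Matrix.conjTranspose_sub, Matrix.conjTranspose_smul, Matrix.conjTranspose_one,
      sub_mul, mul_sub, Matrix.smul_mul, Matrix.mul_smul, one_mul, mul_one, smul_smul]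
    abel
  simp_rw [key, Finset.sum_add_distrib, Finset.sum_sub_distrib, ← Finset.sum_mul,
    ← Finset.mul_sum]
  rw [← hX, ← hXH, hPsum, mul_one]
  abel

/-- The measurement variance dominates the operator variance of the estimate operator. -/
theorem stmt_3 {n N : ℕ} (ρ : Matrix (Fin n) (Fin n) ℂ)
    (hρ : ρ.PosSemidef) (hρtr : ρ.trace = 1)
    (P : Fin N → Matrix (Fin n) (Fin n) ℂ)
    (hP : ∀ j, (P j).PosSemidef) (hPsum : ∑ j, P j = 1)
    (l : Fin N → ℂ) (q : Matrix (Fin n) (Fin n) ℂ) (hq : q = ∑ j, l j • P j)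
    (θ : ℂ) (hθ : θ = (ρ * q).trace) :
    ∑ j, ‖l j - θ‖ ^ 2 * ((ρ * P j).trace).re ≥
      ((ρ * (q - θ • 1) * (q - θ • 1)ᴴ).trace).re := by
  have hX : q - θ • 1 = ∑ j, (l j - θ) • P j := by
    simp_rw [sub_smul, Finset.sum_sub_distrib, ← Finset.smul_sum, hPsum, hq]
  have hnonneg := hρ.re_trace_mul_nonneg
    (Matrix.posSemidef_sum Finset.univ fun j _ =>
      (hP j).mul_mul_conjTranspose_same ((l j - θ) • 1 - (q - θ • 1)))
  rw [sum_conj_povm_eq (fun j => (hP j).isHermitian) hPsum _ hX, mul_sub, Matrix.trace_sub,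
    Complex.sub_re, ← Matrix.mul_assoc, Finset.mul_sum, Matrix.trace_sum, Complex.re_sum] at hnonneg
  simp_rw [Matrix.mul_smul, Matrix.trace_smul, smul_eq_mul, Complex.re_ofReal_mul] at hnonneg
  linarith
end

section
/- Let ρ be a density matrix, Π : Fin N → Matrix (Fin n) (Fin n) ℂ a finite POVM, and λ : Fin N → Fin m → ℂ outcome values for m simultaneously estimated complex parameters. Set q i := ∑ j, λ j i • Π j and θ i := Tr(ρ * q i). Let h : Fin k → Matrix (Fin n) (Fin n) ℂ be matrices (logarithmic derivatives) such that the information matrix H ∈ Matrix (Fin k) (Fin k) ℂ, H k' l := Tr(h k' * (h l)ᴴ * ρ), is positive definite, and define D ∈ Matrix (Fin m) (Fin k) ℂ by D i k' := Tr(ρ * (q i − θ i • 1) * (h k')ᴴ). Then the covariance matrix R ∈ Matrix (Fin m) (Fin m) ℂ, R i i' := ∑ j, (λ j i − θ i) * conj (λ j i' − θ i') * Tr(ρ * Π j), satisfies: R − D * H⁻¹ * Dᴴ is positive semidefinite. -/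
open scoped Matrix ComplexOrder

open scoped MatrixOrder Matrix.Norms.L2Operator in
/-- The weighted trace form `(X, Y) ↦ Tr (ρ X P Yᴴ)` of two positive semidefinite weights has
positive semidefinite Gram matrices. -/
theorem posSemidef_trace_mul_mul_mul_conjTranspose {ι n : Type*} [Fintype ι] [Fintype n]
    [DecidableEq n] {ρ P : Matrix n n ℂ} (hρ : ρ.PosSemidef) (hP : P.PosSemidef)
    (Y : ι → Matrix n n ℂ) :
    (Matrix.of fun a b => (ρ * Y a * P * (Y b)ᴴ).trace).PosSemidef := by
  obtain ⟨E, rfl⟩ := CStarAlgebra.nonneg_iff_eq_star_mul_self.mp hρ.nonneg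
  obtain ⟨C, rfl⟩ := CStarAlgebra.nonneg_iff_eq_star_mul_self.mp hP.nonneg
  simp only [Matrix.star_eq_conjTranspose]
  let Z : Matrix ι (n × n) ℂ := Matrix.of fun a s => (E * Y a * Cᴴ) s.1 s.2
  convert Matrix.posSemidef_self_mul_conjTranspose Z using 1
  ext a b
  have key : (Eᴴ * E * Y a * (Cᴴ * C) * (Y b)ᴴ).trace
      = ((E * Y a * Cᴴ) * (E * Y b * Cᴴ)ᴴ).trace := by
    rw [show Eᴴ * E * Y a * (Cᴴ * C) * (Y b)ᴴ = Eᴴ * (E * Y a * Cᴴ * C * (Y b)ᴴ) by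
      simp only [Matrix.mul_assoc], Matrix.trace_mul_comm]
    simp only [Matrix.conjTranspose_mul, Matrix.conjTranspose_conjTranspose, Matrix.mul_assoc]
  rw [Matrix.of_apply, key, Matrix.mul_apply, Fintype.sum_prod_type]
  rfl

/-- Discrete finite-dimensional form of the complex (right) generalized Cramér–Rao
inequality `R ≥ D H⁻¹ D†`. -/
theorem stmt_6 {n N m k : ℕ} (ρ : Matrix (Fin n) (Fin n) ℂ)
    (hρ : ρ.PosSemidef) (hρtr : ρ.trace = 1)
    (P : Fin N → Matrix (Fin n) (Fin n) ℂ)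
    (hP : ∀ j, (P j).PosSemidef) (hPsum : ∑ j, P j = 1)
    (l : Fin N → Fin m → ℂ)
    (q : Fin m → Matrix (Fin n) (Fin n) ℂ) (hq : ∀ i, q i = ∑ j, l j i • P j)
    (θ : Fin m → ℂ) (hθ : ∀ i, θ i = (ρ * q i).trace)
    (h : Fin k → Matrix (Fin n) (Fin n) ℂ)
    (H : Matrix (Fin k) (Fin k) ℂ) (hH : ∀ k' l', H k' l' = (h k' * (h l')ᴴ * ρ).trace)
    (hHpd : H.PosDef)
    (D : Matrix (Fin m) (Fin k) ℂ)
    (hD : ∀ i k', D i k' = (ρ * (q i - θ i • 1) * (h k')ᴴ).trace)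
    (R : Matrix (Fin m) (Fin m) ℂ)
    (hR : ∀ i i', R i i' =
      ∑ j, (l j i - θ i) * (starRingEnd ℂ) (l j i' - θ i') * (ρ * P j).trace) :
    (R - D * H⁻¹ * Dᴴ).PosSemidef := by
  have hDsum : ∀ i k', ∑ j, (l j i - θ i) * (ρ * P j * (h k')ᴴ).trace = D i k' := by
    intro i k'
    have hx : q i - θ i • 1 = ∑ j, (l j i - θ i) • P j := by
      rw [hq, ← hPsum, Finset.smul_sum, ← Finset.sum_sub_distrib]
      simp only [sub_smul]
    rw [hD, hx]
    simp only [Matrix.mul_sum, Matrix.sum_mul, Matrix.trace_sum, Matrix.mul_smul,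
      Matrix.smul_mul, Matrix.trace_smul, smul_eq_mul]
  let Y (j : Fin N) : Fin m ⊕ Fin k → Matrix (Fin n) (Fin n) ℂ :=
    Sum.elim (fun i => (l j i - θ i) • 1) h
  have hG := Matrix.posSemidef_sum Finset.univ fun j _ =>
    posSemidef_trace_mul_mul_mul_conjTranspose hρ (hP j) (Y j)
  let := hHpd.isUnit.invertible
  rw [← hHpd.fromBlocks₂₂]
  suffices hE : Matrix.fromBlocks R D Dᴴ H = ∑ j, Matrix.of fun a b =>
      (ρ * Y j a * P j * (Y j b)ᴴ).trace by
    rw [hE]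
    exact hG
  have hR' : ∀ i i', R i i' = (∑ j, Matrix.of fun a b =>
      (ρ * Y j a * P j * (Y j b)ᴴ).trace) (Sum.inl i) (Sum.inl i') := by
    intro i i'
    simp only [hR, Matrix.sum_apply, Matrix.of_apply, Y, Sum.elim_inl,
      Matrix.conjTranspose_smul, Matrix.conjTranspose_one, Matrix.mul_smul, Matrix.smul_mul,
      Matrix.mul_one, Matrix.trace_smul, smul_eq_mul, starRingEnd_apply]
    exact Finset.sum_congr rfl fun j _ => by ring
  have hD' : ∀ i k', D i k' = (∑ j, Matrix.of fun a b =>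
      (ρ * Y j a * P j * (Y j b)ᴴ).trace) (Sum.inl i) (Sum.inr k') := by
    intro i k'
    simp only [← hDsum, Matrix.sum_apply, Matrix.of_apply, Y, Sum.elim_inl, Sum.elim_inr,
      Matrix.mul_smul, Matrix.smul_mul, Matrix.mul_one, Matrix.trace_smul, smul_eq_mul]
  refine Matrix.ext ?_
  rintro (i | k') (i' | l')
  · exact hR' i i'
  · exact hD' i l'
  · rw [Matrix.fromBlocks_apply₂₁, Matrix.conjTranspose_apply, hD']
    exact hG.isHermitian.apply _ _
  · rw [Matrix.fromBlocks_apply₂₂, hH, Matrix.trace_mul_comm, ← Matrix.mul_assoc]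
    simp only [Matrix.sum_apply, Matrix.of_apply, Y, Sum.elim_inr]
    rw [← Matrix.trace_sum, ← Matrix.sum_mul, ← Matrix.mul_sum, hPsum, Matrix.mul_one]
end

section
/- Let ρ be a density matrix, g : Fin m → Matrix (Fin n) (Fin n) ℂ Hermitian matrices, and D : Fin m → Matrix (Fin n) (Fin n) ℂ matrices with ρ * g i + g i * ρ = (2 : ℂ) • D i and Tr(D i) = 0 for all i (so the g i are symmetrized logarithmic derivatives of an m-parameter family with partial derivatives D i). Let Π : Fin N → Matrix (Fin n) (Fin n) ℂ be a finite POVM with real outcomes λ : Fin N → Fin m → ℝ, q i := ∑ j, (λ j i : ℂ) • Π j, θ i := (Tr(ρ * q i)).re, and suppose the differentiated unbiasedness conditions Tr(q i * D k) = if i = k then 1 else 0 hold for all i, k. Assume the real symmetric Fisher information matrix G, G i k := ((1/2) * Tr(ρ * (g i * g k + g k * g i))).re, is positive definite. Then the real covariance matrix R, R i k := ∑ j, (λ j i − θ i) * (λ j k − θ k) * (Tr(ρ * Π j)).re, satisfies: R − G⁻¹ is positive semidefinite (as a real symmetric matrix). -/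
open scoped Matrix ComplexOrder

open scoped MatrixOrder Matrix.Norms.L2Operator in
/-- The trace of a product of two positive semidefinite matrices is nonnegative. -/
theorem trace_mul_nonneg_of_posSemidef {n : Type*} [Fintype n] [DecidableEq n]
    {A B : Matrix n n ℂ} (hA : A.PosSemidef) (hB : B.PosSemidef) : 0 ≤ (A * B).trace := by
  obtain ⟨C, rfl⟩ := CStarAlgebra.nonneg_iff_eq_star_mul_self.mp hA.nonneg
  rw [Matrix.star_eq_conjTranspose, Matrix.mul_assoc, Matrix.trace_mul_comm]
  exact (hB.mul_mul_conjTranspose_same C).trace_nonneg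

/-- One-parameter quantum Cramér–Rao inequality, before optimizing over the scale of `L`. -/
theorem povm_trace_sum_mul_le {n ι : Type*} [Fintype n] [DecidableEq n] [Fintype ι]
    {ρ : Matrix n n ℂ} (hρ : ρ.PosSemidef) {L : Matrix n n ℂ} (hL : Lᴴ = L)
    {P : ι → Matrix n n ℂ}
    (hP : ∀ j, (P j).PosSemidef) (hPsum : ∑ j, P j = 1) (s : ι → ℝ) :
    (((∑ j, (s j : ℂ) • P j) * (ρ * L + L * ρ)).trace).re ≤
      ∑ j, s j ^ 2 * ((ρ * P j).trace).re + ((ρ * (L * L)).trace).re := by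
  have hterm (j : ι) :
      (ρ * ((s j : ℂ) • (1 : Matrix n n ℂ) - L) * P j *
        ((s j : ℂ) • (1 : Matrix n n ℂ) - L)).trace =
      ((s j ^ 2 : ℝ) : ℂ) * (ρ * P j).trace - (((s j : ℂ) • P j) * (ρ * L + L * ρ)).trace +
        (L * ρ * L * P j).trace := by
    have h₁ : (ρ * (P j * L)).trace = (P j * (L * ρ)).trace := by
      rw [Matrix.trace_mul_comm, Matrix.mul_assoc]
    have h₂ : (ρ * (L * P j)).trace = (P j * (ρ * L)).trace := by
      rw [← Matrix.mul_assoc, Matrix.trace_mul_comm]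
    have h₃ : (ρ * (L * (P j * L))).trace = (L * (ρ * (L * P j))).trace := by
      rw [Matrix.trace_mul_comm L]
      simp only [Matrix.mul_assoc]
    simp only [Matrix.mul_sub, Matrix.sub_mul, Matrix.mul_add, Matrix.mul_smul, Matrix.smul_mul,
      Matrix.mul_one, Matrix.trace_sub, Matrix.trace_add, Matrix.trace_smul,
      smul_eq_mul, Matrix.mul_assoc, h₁, h₂, h₃]
    push_cast
    ring
  have hnonneg (j : ι) :
      0 ≤ ((ρ * ((s j : ℂ) • (1 : Matrix n n ℂ) - L) * P j *
        ((s j : ℂ) • (1 : Matrix n n ℂ) - L)).trace).re := by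
    have hA : ((s j : ℂ) • (1 : Matrix n n ℂ) - L)ᴴ = (s j : ℂ) • 1 - L := by
      simp [hL]
    have h := trace_mul_nonneg_of_posSemidef hρ
      ((hP j).mul_mul_conjTranspose_same ((s j : ℂ) • (1 : Matrix n n ℂ) - L))
    rw [hA, ← Matrix.mul_assoc, ← Matrix.mul_assoc] at h
    exact (Complex.le_def.mp h).1
  have hlast : ∑ j, (L * ρ * L * P j).trace = (ρ * (L * L)).trace := by
    rw [← Matrix.trace_sum, ← Matrix.mul_sum, hPsum, Matrix.mul_one, Matrix.mul_assoc,
      Matrix.trace_mul_comm, Matrix.mul_assoc]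
  have hsum := Finset.sum_nonneg fun j (_ : j ∈ Finset.univ) => hnonneg j
  simp only [hterm, Complex.add_re, Complex.sub_re, Complex.re_ofReal_mul,
    Finset.sum_add_distrib, Finset.sum_sub_distrib] at hsum
  rw [← hlast, Matrix.sum_mul, Matrix.trace_sum, Complex.re_sum, Complex.re_sum]
  linarith

/-- Discrete algebraic form of the multiparameter Helstrom Cramér–Rao inequality `R ≥ G⁻¹`. -/
theorem stmt_8 {n m N : ℕ} (ρ : Matrix (Fin n) (Fin n) ℂ)
    (hρ : ρ.PosSemidef) (hρtr : ρ.trace = 1)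
    (g : Fin m → Matrix (Fin n) (Fin n) ℂ) (hgH : ∀ i, (g i)ᴴ = g i)
    (D : Fin m → Matrix (Fin n) (Fin n) ℂ)
    (hD : ∀ i, ρ * g i + g i * ρ = (2 : ℂ) • D i)
    (hDtr : ∀ i, (D i).trace = 0)
    (P : Fin N → Matrix (Fin n) (Fin n) ℂ)
    (hP : ∀ j, (P j).PosSemidef) (hPsum : ∑ j, P j = 1)
    (l : Fin N → Fin m → ℝ)
    (q : Fin m → Matrix (Fin n) (Fin n) ℂ) (hq : ∀ i, q i = ∑ j, ((l j i : ℝ) : ℂ) • P j)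
    (θ : Fin m → ℝ) (hθ : ∀ i, θ i = ((ρ * q i).trace).re)
    (hunb : ∀ i k, (q i * D k).trace = if i = k then 1 else 0)
    (G : Matrix (Fin m) (Fin m) ℝ)
    (hG : ∀ i k, G i k = ((1/2 : ℂ) * (ρ * (g i * g k + g k * g i)).trace).re)
    (hGpd : G.PosDef)
    (R : Matrix (Fin m) (Fin m) ℝ)
    (hR : ∀ i k, R i k = ∑ j, (l j i - θ i) * (l j k - θ k) * ((ρ * P j).trace).re) :
    (R - G⁻¹).PosSemidef := by
  have hRH : R.IsHermitian := by
    ext i k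
    simp only [Matrix.conjTranspose_apply, star_trivial, hR, mul_comm (l _ i - θ i)]
  refine Matrix.PosSemidef.of_dotProduct_mulVec_nonneg (hRH.sub hGpd.isHermitian.inv) fun x => ?_
  set y := G⁻¹ *ᵥ x with hy
  have hGy : G *ᵥ y = x := by
    rw [hy, Matrix.mulVec_mulVec, Matrix.mul_nonsing_inv _
      ((Matrix.isUnit_iff_isUnit_det G).mp hGpd.isUnit), Matrix.one_mulVec]
  set L : Matrix (Fin n) (Fin n) ℂ := ∑ k, (y k : ℂ) • g k with hLdef
  have hL : Lᴴ = L := by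
    simp [hLdef, Matrix.conjTranspose_sum, hgH]
  have key := povm_trace_sum_mul_le hρ hL hP hPsum fun j => ∑ i, x i * (l j i - θ i)
  have hRx : ∑ j, (∑ i, x i * (l j i - θ i)) ^ 2 * ((ρ * P j).trace).re = x ⬝ᵥ R *ᵥ x := by
    simp only [dotProduct, Matrix.mulVec, hR, sq, Finset.sum_mul, Finset.mul_sum]
    rw [Finset.sum_comm]
    refine Finset.sum_congr rfl fun i _ => ?_
    rw [Finset.sum_comm]
    exact Finset.sum_congr rfl fun k _ => Finset.sum_congr rfl fun j _ => by ring
  have hGL : ((ρ * (L * L)).trace).re = x ⬝ᵥ y := by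
    have hquad : ((ρ * (L * L)).trace).re =
        ∑ i, ∑ k, y i * y k * ((ρ * (g i * g k)).trace).re := by
      simp only [hLdef, Matrix.sum_mul, Matrix.smul_mul, Matrix.mul_smul, Matrix.trace_sum,
        Matrix.trace_smul, Complex.re_sum, smul_eq_mul, Complex.re_ofReal_mul,
        Finset.mul_sum]
      rw [Finset.sum_comm]
      exact Finset.sum_congr rfl fun i _ => Finset.sum_congr rfl fun k _ => by ring
    have hswap : ((ρ * (L * L)).trace).re =
        ∑ i, ∑ k, y i * y k * ((ρ * (g k * g i)).trace).re := by
      rw [hquad, Finset.sum_comm]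
      exact Finset.sum_congr rfl fun i _ => Finset.sum_congr rfl fun k _ => by ring
    have hGentry (i k : Fin m) : G i k =
        (((ρ * (g i * g k)).trace).re + ((ρ * (g k * g i)).trace).re) / 2 := by
      have h := hG i k
      rw [show (1 / 2 : ℂ) = ((1 / 2 : ℝ) : ℂ) by norm_num, Complex.re_ofReal_mul,
        Matrix.mul_add, Matrix.trace_add, Complex.add_re] at h
      linarith
    have hyG : x ⬝ᵥ y = ∑ i, ∑ k, y i * y k * G i k := by
      rw [← hGy, dotProduct_comm]
      simp only [dotProduct, Matrix.mulVec, Finset.mul_sum]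
      exact Finset.sum_congr rfl fun i _ => Finset.sum_congr rfl fun k _ => by ring
    have htwo : 2 * (x ⬝ᵥ y) = ((ρ * (L * L)).trace).re + ((ρ * (L * L)).trace).re := by
      nth_rewrite 1 [hquad]
      rw [hswap, hyG, Finset.mul_sum, ← Finset.sum_add_distrib]
      refine Finset.sum_congr rfl fun i _ => ?_
      rw [Finset.mul_sum, ← Finset.sum_add_distrib]
      exact Finset.sum_congr rfl fun k _ => by rw [hGentry]; ring
    linarith
  have hQ : ∑ j, ((∑ i, x i * (l j i - θ i) : ℝ) : ℂ) • P j =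
      ∑ i, (x i : ℂ) • (q i - (θ i : ℂ) • (1 : Matrix (Fin n) (Fin n) ℂ)) := by
    simp only [hq, ← hPsum, Finset.smul_sum, ← Finset.sum_sub_distrib, smul_smul, ← sub_smul]
    rw [Finset.sum_comm]
    refine Finset.sum_congr rfl fun j _ => ?_
    push_cast
    simp only [Finset.sum_smul]
  have hLρ : ρ * L + L * ρ = ∑ k, (2 * y k : ℂ) • D k := by
    simp only [hLdef, Matrix.mul_sum, Matrix.sum_mul, ← Finset.sum_add_distrib, Matrix.mul_smul,
      Matrix.smul_mul, ← smul_add, hD, smul_smul, mul_comm]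
  have hcross : (((∑ j, ((∑ i, x i * (l j i - θ i) : ℝ) : ℂ) • P j) *
      (ρ * L + L * ρ)).trace).re = 2 * (x ⬝ᵥ y) := by
    have h : ((∑ i, (x i : ℂ) • (q i - (θ i : ℂ) • (1 : Matrix (Fin n) (Fin n) ℂ))) *
        ∑ k, (2 * y k : ℂ) • D k).trace = ((2 * (x ⬝ᵥ y) : ℝ) : ℂ) := by
      simp only [Matrix.sum_mul, Matrix.mul_sum, Matrix.smul_mul, Matrix.mul_smul,
        Matrix.sub_mul, Matrix.one_mul, Matrix.trace_sum, Matrix.trace_smul, Matrix.trace_sub,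
        hunb, hDtr, smul_eq_mul, mul_zero, sub_zero, mul_ite, mul_one, Finset.sum_ite_eq',
        Finset.mem_univ, if_true, dotProduct]
      push_cast
      rw [Finset.mul_sum]
      exact Finset.sum_congr rfl fun i _ => by ring
    rw [hQ, hLρ, h, Complex.ofReal_re]
  rw [hcross, hRx, hGL] at key
  rw [star_trivial, Matrix.sub_mulVec, dotProduct_sub, ← hy]
  linarith
end

section
/- Let ρ be a density matrix, s : Fin m → Matrix (Fin n) (Fin n) ℂ pairwise commuting Hermitian matrices with means μ i := Tr(ρ * s i), and q : Fin m → Matrix (Fin n) (Fin n) ℂ Hermitian matrices with means θ i := Tr(ρ * q i). Assume the mean canonical conjugacy relations Tr(ρ * (q i − θ i • 1) * (s k − μ k • 1)) = −(Complex.I/2) * (if i = k then 1 else 0) for all i, k, and assume the covariance matrix S, S i k := Tr(ρ * (s i − μ i • 1) * (s k − μ k • 1)), is positive definite. Then the covariance matrix Q, Q i k := Tr(ρ * (q i − θ i • 1) * (q k − θ k • 1)), satisfies: Q − (1/4 : ℂ) • S⁻¹ is positive semidefinite. -/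
open scoped Matrix ComplexOrder

/-- The second-moment matrix of a family of Hermitian matrices in a state `ρ` is a Gram matrix. -/
theorem Matrix.PosSemidef.of_trace_mul_mul {ι n : Type*} [Fintype ι] [Fintype n] [DecidableEq n]
    {ρ : Matrix n n ℂ} (hρ : ρ.PosSemidef) {E : ι → Matrix n n ℂ} (hE : ∀ i, (E i)ᴴ = E i) :
    (Matrix.of fun i k => (ρ * E i * E k).trace).PosSemidef := by
  obtain ⟨K, rfl⟩ : ∃ K : Matrix n n ℂ, ρ = Kᴴ * K := by
    open scoped MatrixOrder in
    exact CStarAlgebra.nonneg_iff_eq_star_mul_self.mp hρ.nonneg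
  let M : Matrix (n × n) ι ℂ := Matrix.of fun p i => (E i * Kᴴ) p.1 p.2
  convert Matrix.posSemidef_conjTranspose_mul_self M
  ext i k
  have h : (Kᴴ * K * E i * E k).trace = ((E i * Kᴴ)ᴴ * (E k * Kᴴ)).trace := by
    rw [Matrix.conjTranspose_mul, Matrix.conjTranspose_conjTranspose, hE, Matrix.mul_assoc,
      Matrix.mul_assoc, Matrix.trace_mul_comm]
    simp only [Matrix.mul_assoc]
  rw [Matrix.of_apply, h, Matrix.trace, Matrix.mul_apply, Fintype.sum_prod_type_right]
  simp only [Matrix.diag_apply, Matrix.mul_apply (M := (E i * Kᴴ)ᴴ), Matrix.conjTranspose_apply]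
  rfl

/-- Centering a Hermitian matrix at its mean in a state leaves it Hermitian. -/
theorem Matrix.conjTranspose_sub_trace_smul_one {n : Type*} [Fintype n] [DecidableEq n]
    {ρ : Matrix n n ℂ} (hρ : ρᴴ = ρ) {A : Matrix n n ℂ} (hA : Aᴴ = A) :
    (A - (ρ * A).trace • (1 : Matrix n n ℂ))ᴴ = A - (ρ * A).trace • (1 : Matrix n n ℂ) := by
  have h : star (ρ * A).trace = (ρ * A).trace := by
    rw [← Matrix.trace_conjTranspose, Matrix.conjTranspose_mul, hρ, hA, Matrix.trace_mul_comm]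
  rw [Matrix.conjTranspose_sub, Matrix.conjTranspose_smul, hA, h, Matrix.conjTranspose_one]

/-- Multidimensional generalized uncertainty relation `Q ≥ (1/4) S⁻¹` for unbiased estimators
of the canonical parameters of a translation group with commuting generators. -/
theorem stmt_10 {n m : ℕ} (ρ : Matrix (Fin n) (Fin n) ℂ)
    (hρ : ρ.PosSemidef) (hρtr : ρ.trace = 1)
    (s : Fin m → Matrix (Fin n) (Fin n) ℂ)
    (hsH : ∀ i, (s i)ᴴ = s i) (hscomm : ∀ i k, s i * s k = s k * s i)
    (μ : Fin m → ℂ) (hμ : ∀ i, μ i = (ρ * s i).trace)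
    (q : Fin m → Matrix (Fin n) (Fin n) ℂ) (hqH : ∀ i, (q i)ᴴ = q i)
    (θ : Fin m → ℂ) (hθ : ∀ i, θ i = (ρ * q i).trace)
    (hconj : ∀ i k, (ρ * (q i - θ i • 1) * (s k - μ k • 1)).trace =
      -(Complex.I / 2) * (if i = k then 1 else 0))
    (S : Matrix (Fin m) (Fin m) ℂ)
    (hS : ∀ i k, S i k = (ρ * (s i - μ i • 1) * (s k - μ k • 1)).trace)
    (hSpd : S.PosDef)
    (Q : Matrix (Fin m) (Fin m) ℂ)
    (hQ : ∀ i k, Q i k = (ρ * (q i - θ i • 1) * (q k - θ k • 1)).trace) :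
    (Q - (1/4 : ℂ) • S⁻¹).PosSemidef := by
  have hA : ∀ i, (q i - θ i • (1 : Matrix (Fin n) (Fin n) ℂ))ᴴ = q i - θ i • 1 := fun i => by
    rw [hθ]; exact Matrix.conjTranspose_sub_trace_smul_one hρ.isHermitian (hqH i)
  have hB : ∀ i, (s i - μ i • (1 : Matrix (Fin n) (Fin n) ℂ))ᴴ = s i - μ i • 1 := fun i => by
    rw [hμ]; exact Matrix.conjTranspose_sub_trace_smul_one hρ.isHermitian (hsH i)
  let E : Fin m ⊕ Fin m → Matrix (Fin n) (Fin n) ℂ :=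
    Sum.elim (fun i => q i - θ i • 1) (fun i => s i - μ i • 1)
  have hG := hρ.of_trace_mul_mul (E := E) (Sum.forall.2 ⟨hA, hB⟩)
  let C : Matrix (Fin m) (Fin m) ℂ := (-(Complex.I / 2)) • 1
  have hblocks : (Matrix.of fun i k => (ρ * E i * E k).trace) = Matrix.fromBlocks Q C Cᴴ S := by
    have hC : ∀ i k, (ρ * (q i - θ i • 1) * (s k - μ k • 1)).trace = C i k := fun i k => by
      simp only [hconj, C, Matrix.smul_apply, Matrix.one_apply, smul_eq_mul]
    ext (i | i) (k | k)
    · exact (hQ i k).symm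
    · exact hC i k
    · have h := hG.isHermitian.apply (Sum.inr i) (Sum.inl k)
      exact h.symm.trans (congrArg star (hC k i))
    · exact (hS i k).symm
  rw [hblocks] at hG
  have := hSpd.isUnit.invertible
  have hschur := (Matrix.PosDef.fromBlocks₂₂ Q C hSpd).mp hG
  have hCSC : C * S⁻¹ * Cᴴ = (1 / 4 : ℂ) • S⁻¹ := by
    have hc : star (-(Complex.I / 2)) * -(Complex.I / 2) = 1 / 4 := by
      simp only [Complex.star_def, map_neg, map_div₀, Complex.conj_I, map_ofNat]
      linear_combination (-1 / 4 : ℂ) * Complex.I_mul_I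
    simp only [C, Matrix.conjTranspose_smul, Matrix.conjTranspose_one, Matrix.smul_mul,
      Matrix.mul_smul, Matrix.one_mul, Matrix.mul_one, smul_smul]
    rw [hc]
  rwa [hCSC] at hschur
end

section
/- Let Π : Fin N → Matrix (Fin n) (Fin n) ℂ be a finite POVM and x : Fin m → Matrix (Fin n) (Fin n) ℂ matrices admitting Π as a joint right-eigen resolution of the identity, i.e. x k * Π j = (κ j k) • Π j for all j, k, where κ : Fin N → Fin m → ℂ. Then: (a) x k = ∑ j, κ j k • Π j for every k; (b) the x k mutually commute: x i * x k = x k * x i for all i, k; and (c) x i * (x k)ᴴ = ∑ j, (κ j i * conj (κ j k)) • Π j for all i, k (even though x i and (x k)ᴴ need not commute). -/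
open scoped Matrix ComplexOrder

/-- Operator identities for matrices admitting a joint right-eigen resolution of the identity:
the `x k` are sums of eigenvalue-weighted POVM elements, mutually commute, and satisfy the
product formula for `x i * (x k)ᴴ`. -/
theorem stmt_16 {n N m : ℕ} (P : Fin N → Matrix (Fin n) (Fin n) ℂ)
    (hP : ∀ j, (P j).PosSemidef) (hPsum : ∑ j, P j = 1)
    (κ : Fin N → Fin m → ℂ)
    (x : Fin m → Matrix (Fin n) (Fin n) ℂ)
    (hx : ∀ j k, x k * P j = κ j k • P j) :
    (∀ k, x k = ∑ j, κ j k • P j) ∧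
    (∀ i k, x i * x k = x k * x i) ∧
    (∀ i k, x i * (x k)ᴴ = ∑ j, (κ j i * (starRingEnd ℂ) (κ j k)) • P j) := by
  have hsum : ∀ k, x k = ∑ j, κ j k • P j := fun k => by
    calc x k = x k * ∑ j, P j := by rw [hPsum, mul_one]
      _ = ∑ j, κ j k • P j := by simp only [Finset.mul_sum, hx]
  have hmul : ∀ i k, x i * x k = ∑ j, (κ j k * κ j i) • P j := fun i k => by
    conv_lhs => rw [hsum k]
    simp only [Finset.mul_sum, mul_smul_comm, hx, smul_smul]
  refine ⟨hsum, fun i k => ?_, fun i k => ?_⟩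
  · rw [hmul, hmul]
    simp only [mul_comm]
  · have hadj : (x k)ᴴ = ∑ j, (starRingEnd ℂ) (κ j k) • P j := by
      conv_lhs => rw [hsum k]
      simp only [Matrix.conjTranspose_sum, Matrix.conjTranspose_smul, (hP _).isHermitian.eq,
        starRingEnd_apply]
    rw [hadj]
    simp only [Finset.mul_sum, mul_smul_comm, hx, smul_smul, mul_comm]
end

section
/- Let Π : Fin N → Matrix (Fin n) (Fin n) ℂ be a finite POVM, κ : Fin N → Fin m → ℂ, and x : Fin m → Matrix (Fin n) (Fin n) ℂ with x k * Π j = (κ j k) • Π j for all j, k. Let ρ be a density matrix and θ k := Tr(ρ * x k). Then the measurement covariance matrix of the quasimeasurement outcomes equals the operator covariance matrix: for all i, k, ∑ j, (κ j i − θ i) * conj (κ j k − θ k) * Tr(ρ * Π j) = Tr(ρ * (x i − θ i • 1) * ((x k − θ k • 1))ᴴ). In particular the quasimeasurement described by Π is a right-efficient unbiased estimate of the parameters θ k, attaining the right Cramér–Rao bound R = H. -/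
open scoped Matrix ComplexOrder

/-- A family of Hermitian matrices resolving the identity and consisting of joint right
eigenmatrices of `A` and `B` diagonalizes the product `A * Bᴴ`. -/
theorem mul_conjTranspose_eq_sum_smul {n ι : Type*} [Fintype n] [DecidableEq n] [Fintype ι]
    {P : ι → Matrix n n ℂ} (hP : ∀ j, (P j).IsHermitian) (hPsum : ∑ j, P j = 1)
    {A B : Matrix n n ℂ} {a b : ι → ℂ} (hA : ∀ j, A * P j = a j • P j)
    (hB : ∀ j, B * P j = b j • P j) :
    A * Bᴴ = ∑ j, (a j * (starRingEnd ℂ) (b j)) • P j := by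
  have hB' (j : ι) : P j * Bᴴ = (starRingEnd ℂ) (b j) • P j := by
    simpa [Matrix.conjTranspose_mul, (hP j).eq] using congrArg Matrix.conjTranspose (hB j)
  calc A * Bᴴ = A * (∑ j, P j) * Bᴴ := by rw [hPsum, mul_one]
    _ = ∑ j, (a j * (starRingEnd ℂ) (b j)) • P j := by
      simp only [Finset.mul_sum, Finset.sum_mul, hA, Matrix.smul_mul, hB', smul_smul]

/-- Attainability: for operators with a joint right-eigen POVM, the covariance matrix of the
quasimeasurement outcomes equals the operator covariance matrix (right efficiency, `R = H`). -/
theorem stmt_17 {n N m : ℕ} (P : Fin N → Matrix (Fin n) (Fin n) ℂ)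
    (hP : ∀ j, (P j).PosSemidef) (hPsum : ∑ j, P j = 1)
    (κ : Fin N → Fin m → ℂ)
    (x : Fin m → Matrix (Fin n) (Fin n) ℂ)
    (hx : ∀ j k, x k * P j = κ j k • P j)
    (ρ : Matrix (Fin n) (Fin n) ℂ) (hρ : ρ.PosSemidef) (hρtr : ρ.trace = 1)
    (θ : Fin m → ℂ) (hθ : ∀ k, θ k = (ρ * x k).trace) :
    ∀ i k, ∑ j, (κ j i - θ i) * (starRingEnd ℂ) (κ j k - θ k) * (ρ * P j).trace =
      (ρ * (x i - θ i • 1) * (x k - θ k • 1)ᴴ).trace := by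
  intro i k
  have hshift (l : Fin m) (j : Fin N) :
      (x l - θ l • 1) * P j = (κ j l - θ l) • P j := by
    rw [sub_mul, hx, Matrix.smul_mul, one_mul, sub_smul]
  rw [mul_assoc, mul_conjTranspose_eq_sum_smul (fun j => (hP j).isHermitian) hPsum
    (hshift i) (hshift k)]
  simp only [Finset.mul_sum, Matrix.trace_sum, Matrix.mul_smul, Matrix.trace_smul, smul_eq_mul]
end

section
/- Let Π : Fin N → Matrix (Fin n) (Fin n) ℂ be a family of positive semidefinite matrices, λ : Fin N → ℂ, and q ∈ Matrix (Fin n) (Fin n) ℂ. If ∑ j, (λ j • 1 − q) * Π j * ((λ j • 1 − q))ᴴ = 0, then q * Π j = λ j • Π j for every j. -/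
open scoped Matrix ComplexOrder

open scoped MatrixOrder in
/-- For positive semidefinite `A`, the congruence `B * A * Bᴴ` vanishes only if `B * A` does. -/
theorem Matrix.PosSemidef.mul_eq_zero_of_mul_mul_conjTranspose_eq_zero {m n 𝕜 : Type*}
    [Fintype m] [Fintype n] [RCLike 𝕜] {A : Matrix n n 𝕜} (hA : A.PosSemidef)
    {B : Matrix m n 𝕜} (h : B * A * Bᴴ = 0) : B * A = 0 := by
  classical
  obtain ⟨C, rfl⟩ := CStarAlgebra.nonneg_iff_eq_star_mul_self.mp hA.nonneg
  rw [Matrix.star_eq_conjTranspose] at h ⊢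
  have hBC : B * Cᴴ = 0 := by
    rw [← Matrix.self_mul_conjTranspose_eq_zero, Matrix.conjTranspose_mul,
      Matrix.conjTranspose_conjTranspose]
    simpa only [Matrix.mul_assoc] using h
  rw [← Matrix.mul_assoc, hBC, Matrix.zero_mul]

open scoped MatrixOrder in
/-- If a finite sum of positive semidefinite matrices vanishes, so does each summand. -/
theorem Matrix.PosSemidef.eq_zero_of_sum_eq_zero {ι n 𝕜 : Type*} [Fintype ι] [Fintype n]
    [RCLike 𝕜] {A : ι → Matrix n n 𝕜} (hA : ∀ i, (A i).PosSemidef) (h : ∑ i, A i = 0) (i : ι) :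
    A i = 0 :=
  (Finset.sum_eq_zero_iff_of_nonneg fun j _ => (hA j).nonneg).mp h i (Finset.mem_univ i)

/-- If the measurement-noise operator vanishes, the estimate operator admits the POVM as a
right-eigen resolution of the identity. -/
theorem stmt_18 {n N : ℕ} (P : Fin N → Matrix (Fin n) (Fin n) ℂ)
    (hP : ∀ j, (P j).PosSemidef)
    (l : Fin N → ℂ) (q : Matrix (Fin n) (Fin n) ℂ)
    (h0 : ∑ j, (l j • 1 - q) * P j * (l j • 1 - q)ᴴ = 0) :
    ∀ j, q * P j = l j • P j := by
  intro j
  have hj := Matrix.PosSemidef.eq_zero_of_sum_eq_zero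
    (fun i => (hP i).mul_mul_conjTranspose_same (l i • 1 - q)) h0 j
  have hmul := (hP j).mul_eq_zero_of_mul_mul_conjTranspose_eq_zero hj
  rw [Matrix.sub_mul, Matrix.smul_mul, Matrix.one_mul, sub_eq_zero] at hmul
  exact hmul.symm
end
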